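/- Let α be a finite set with n = |α|, δ a non-negative integer, and Γ : α → {0, 1, ..., n} a total mapping. Let x₀ ∈ α with Γ(x₀) = 0 and let k ∈ {1, ..., n} be such that 0 < |{x ∈ α : Γ(x) = k}| ≤ δ. Define Γ' to agree with Γ everywhere except Γ'(x₀) = k. Then μ(Γ') = μ(Γ) − 1, where μ(Γ) = Σ_{j ∈ β(Γ)} (δ − |{x ∈ α : Γ(x) = j}| + 1). -/

import Mathlib

/-- The size of the part `j` of a mapping `Γ`, i.e. `|{x : Γ(x) = j}|`. -/
def fiberCard {α : Type*} [Fintype α] (Γ : α → ℕ) (j : ℕ) : ℕ :=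
  (Finset.univ.filter (fun x => Γ x = j)).card

/-- `β(Γ) = {j ∈ {1,…,n} : 0 < |{x : Γ(x) = j}| ≤ δ}`. -/
def betaSet {α : Type*} [Fintype α] (n δ : ℕ) (Γ : α → ℕ) : Finset ℕ :=
  (Finset.Icc 1 n).filter (fun j => 0 < fiberCard Γ j ∧ fiberCard Γ j ≤ δ)

/-- `μ(Γ) = Σ_{j ∈ β(Γ)} (δ − |{x : Γ(x) = j}| + 1)`. -/
def mu {α : Type*} [Fintype α] (n δ : ℕ) (Γ : α → ℕ) : ℕ :=
  ∑ j ∈ betaSet n δ Γ, (δ - fiberCard Γ j + 1)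

theorem fiberCard_update_self {α : Type*} [Fintype α] [DecidableEq α] (Γ : α → ℕ) {x₀ : α}
    {k : ℕ} (h : Γ x₀ ≠ k) : fiberCard (Function.update Γ x₀ k) k = fiberCard Γ k + 1 := by
  have hs : Finset.univ.filter (fun x => Function.update Γ x₀ k x = k) =
      insert x₀ (Finset.univ.filter (fun x => Γ x = k)) := by
    ext x
    by_cases hx : x = x₀ <;> simp [hx]
  rw [fiberCard, hs, Finset.card_insert_of_notMem (by simpa using h), fiberCard]

theorem fiberCard_update_of_ne {α : Type*} [Fintype α] [DecidableEq α] (Γ : α → ℕ) {x₀ : α}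
    {j k : ℕ} (h : Γ x₀ ≠ j) (hkj : k ≠ j) :
    fiberCard (Function.update Γ x₀ k) j = fiberCard Γ j := by
  unfold fiberCard
  congr 1
  ext x
  by_cases hx : x = x₀
  · subst hx
    simp [h, hkj]
  · simp [hx]

theorem mu_eq_sum_Icc {α : Type*} [Fintype α] (n δ : ℕ) (Γ : α → ℕ) :
    mu n δ Γ = ∑ j ∈ Finset.Icc 1 n,
      if 0 < fiberCard Γ j ∧ fiberCard Γ j ≤ δ then δ - fiberCard Γ j + 1 else 0 := by
  rw [mu, betaSet, Finset.sum_filter]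

/-- Mapping an unassigned element `x₀` to a value `k ∈ {1,…,n}` whose part is nonempty
with at most `δ` elements decreases `μ` by exactly `1`. -/
theorem statement_8 (α : Type*) [Fintype α] [DecidableEq α]
    (n δ : ℕ) (hn : n = Fintype.card α)
    (Γ : α → ℕ) (hbound : ∀ x, Γ x ≤ n)
    (x₀ : α) (hx₀ : Γ x₀ = 0)
    (k : ℕ) (hk : k ∈ Finset.Icc 1 n)
    (hk1 : 0 < fiberCard Γ k) (hk2 : fiberCard Γ k ≤ δ)
    (Γ' : α → ℕ) (hΓ' : Γ' = Function.update Γ x₀ k) :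
    mu n δ Γ' = mu n δ Γ - 1 := by
  subst hΓ'
  have hk0 : 1 ≤ k := (Finset.mem_Icc.mp hk).1
  have hself := fiberCard_update_self Γ (x₀ := x₀) (k := k) (by omega)
  rw [mu_eq_sum_Icc, mu_eq_sum_Icc, ← Finset.add_sum_erase _ _ hk,
    ← Finset.add_sum_erase (Finset.Icc 1 n) _ hk, hself]
  have hrest : ∀ j ∈ (Finset.Icc 1 n).erase k,
      fiberCard (Function.update Γ x₀ k) j = fiberCard Γ j := by
    intro j hj
    obtain ⟨hjk, hj⟩ := Finset.mem_erase.mp hj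
    have hj1 := (Finset.mem_Icc.mp hj).1
    exact fiberCard_update_of_ne Γ (by omega) (Ne.symm hjk)
  rw [Finset.sum_congr rfl fun j hj => by rw [hrest j hj]]
  split_ifs <;> omega
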